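/- arXiv:math/0204073 — 2 statements merged into one kernel-verified Lean document; each statement's English description precedes it below -/
import Mathlib

section
/- Let D be the open unit polydisk in ℂⁿ and let f be holomorphic on an open set containing the closed unit polydisk D̄. Let K ⊂ D be a compact set whose Euclidean distance (in ℂⁿ ≅ ℝ^{2n}) to the boundary of D is d > 0. Then max_{z ∈ K} |f(z)| ≤ (√n)ⁿ / (√π · d)ⁿ · ( ∫_D |f|² dλ )^{1/2}. -/
open MeasureTheory

lemma bergman_submean (n : ℕ) (g : (Fin n → ℂ) → ℂ) (z : Fin n → ℂ) (r : ℝ)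
    (hg : DifferentiableOn ℂ g (Metric.ball z r)) :
    ‖g z‖ₑ * volume (Metric.ball z r) ≤ ∫⁻ w in Metric.ball z r, ‖g w‖ₑ := by
  classical
  set h : (Fin n → ℂ) → ENNReal := (Metric.ball z r).indicator (fun w => ‖g w‖ₑ) with hh
  have hmeas : Measurable h := by
    rw [hh, ← Set.piecewise_eq_indicator]
    exact ContinuousOn.measurable_piecewise hg.continuousOn.enorm
      continuousOn_const measurableSet_ball
  have key : ∀ w ∈ Metric.ball (0 : Fin n → ℂ) r,
      ‖g z‖ₑ * ENNReal.ofReal (2 * Real.pi) ≤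
        ∫⁻ θ in Set.Ioc 0 (2 * Real.pi), h (z + circleMap 0 1 θ • w) := by
    intro w hw
    have hw' : ‖w‖ < r := by simpa using hw
    have hmem : ∀ l : ℂ, ‖l‖ ≤ 1 → z + l • w ∈ Metric.ball z r := by
      intro l hl
      simp only [Metric.mem_ball, dist_self_add_left, norm_smul]
      nlinarith [norm_nonneg w, norm_nonneg l]
    have hd : ∀ l : ℂ, ‖l‖ ≤ 1 → DifferentiableAt ℂ (fun l : ℂ => g (z + l • w)) l := by
      intro l hl
      have h1 : DifferentiableAt ℂ g (z + l • w) :=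
        hg.differentiableAt (Metric.isOpen_ball.mem_nhds (hmem l hl))
      have h2 : DifferentiableAt ℂ (fun l : ℂ => z + l • w) l := by fun_prop
      exact h1.comp l h2
    have hav := circleAverage_of_differentiable_on_off_countable (c := 0) (R := 1)
      (f := fun l : ℂ => g (z + l • w)) Set.countable_empty
      (fun l hl => (hd l (by simpa using hl)).continuousAt.continuousWithinAt)
      (fun l hl => hd l (by have h := hl.1; rw [abs_one, mem_ball_zero_iff] at h; exact h.le))
    rw [Real.circleAverage_def, zero_smul, add_zero] at hav
    have hpi : (0:ℝ) < 2 * Real.pi := by positivity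
    have e1 : ∫ θ in (0:ℝ)..2 * Real.pi, g (z + circleMap 0 1 θ • w)
        = (2 * Real.pi) • g z := by
      rw [← hav, smul_smul, mul_inv_cancel₀ hpi.ne', one_smul]
    rw [intervalIntegral.integral_of_le hpi.le] at e1
    have e2 := enorm_integral_le_lintegral_enorm (μ := volume.restrict (Set.Ioc 0 (2 * Real.pi)))
      (fun θ : ℝ => g (z + circleMap 0 1 θ • w))
    rw [e1, enorm_smul, Real.enorm_of_nonneg hpi.le, mul_comm] at e2
    refine e2.trans (le_of_eq ?_)
    refine lintegral_congr fun θ => ?_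
    rw [hh, Set.indicator_of_mem (hmem _ (by simp))]
  have inv : ∀ θ : ℝ, ∫⁻ w, h (z + circleMap 0 1 θ • w) = ∫⁻ w, h w := by
    intro θ
    have hnorm : ‖circleMap 0 1 θ‖ = 1 := by simp
    have mp1 : MeasurePreserving (fun x : ℂ => circleMap 0 1 θ * x) := by
      have := (rotation ⟨circleMap 0 1 θ, mem_sphere_zero_iff_norm.2 hnorm⟩).measurePreserving
      exact this
    have mp : MeasurePreserving (fun (x : Fin n → ℂ) => circleMap 0 1 θ • x) :=
      volume_preserving_pi (fun _ : Fin n => mp1)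
    rw [← lintegral_add_left_eq_self h z]
    exact mp.lintegral_comp (hmeas.comp (measurable_const_add z))
  have hpi0 : ENNReal.ofReal (2 * Real.pi) ≠ 0 := by
    simpa using Real.pi_pos
  have hvol : volume (Metric.ball z r) = volume (Metric.ball (0 : Fin n → ℂ) r) :=
    Measure.addHaar_ball_center _ _ _
  have hI : ∫⁻ w in Metric.ball z r, ‖g w‖ₑ = ∫⁻ w, h w :=
    (lintegral_indicator measurableSet_ball _).symm
  rw [hI, hvol, ← ENNReal.mul_le_mul_iff_right hpi0 ENNReal.ofReal_ne_top]
  calc ENNReal.ofReal (2 * Real.pi) * (‖g z‖ₑ * volume (Metric.ball (0 : Fin n → ℂ) r))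
      = ∫⁻ w in Metric.ball (0 : Fin n → ℂ) r, ‖g z‖ₑ * ENNReal.ofReal (2 * Real.pi) := by
        rw [setLIntegral_const]; ring
    _ ≤ ∫⁻ w in Metric.ball (0 : Fin n → ℂ) r,
          ∫⁻ θ in Set.Ioc 0 (2 * Real.pi), h (z + circleMap 0 1 θ • w) :=
        setLIntegral_mono' measurableSet_ball key
    _ ≤ ∫⁻ w : Fin n → ℂ,
          ∫⁻ θ in Set.Ioc 0 (2 * Real.pi), h (z + circleMap 0 1 θ • w) :=
        setLIntegral_le_lintegral _ _
    _ = ∫⁻ θ in Set.Ioc 0 (2 * Real.pi), ∫⁻ w : Fin n → ℂ, h (z + circleMap 0 1 θ • w) := by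
        refine lintegral_lintegral_swap (Measurable.aemeasurable ?_)
        refine hmeas.comp (Continuous.measurable ?_)
        have := continuous_circleMap 0 1
        fun_prop
    _ = ENNReal.ofReal (2 * Real.pi) * ∫⁻ w, h w := by
        simp_rw [inv]
        rw [setLIntegral_const, Real.volume_Ioc, sub_zero, mul_comm]

theorem bergman_inequality (n : ℕ) (D : Set (Fin n → ℂ))
    (hD : D = {z : Fin n → ℂ | ∀ i, ‖z i‖ < 1})
    (O : Set (Fin n → ℂ)) (hO : IsOpen O) (hDO : closure D ⊆ O)
    (f : (Fin n → ℂ) → ℂ) (hf : DifferentiableOn ℂ f O)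
    (K : Set (Fin n → ℂ)) (hK : IsCompact K) (hKD : K ⊆ D)
    (d : ℝ) (hd : 0 < d)
    (hdist : d = sInf {t : ℝ | ∃ z ∈ K, ∃ w ∈ frontier D,
      t = Real.sqrt (∑ i, ‖z i - w i‖ ^ 2)}) :
    ∀ z ∈ K, ‖f z‖ ≤ (Real.sqrt n) ^ n / (Real.sqrt Real.pi * d) ^ n *
      Real.sqrt (∫ w in D, ‖f w‖ ^ 2 ∂volume) := by
  classical
  intro z hz
  have hDb : D = Metric.ball 0 1 := by
    rw [hD]; ext w
    simp [pi_norm_lt_iff one_pos]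
  have hfr : frontier D = Metric.sphere 0 1 := by
    rw [hDb, frontier_ball _ one_ne_zero]
  have hcl : closure D = Metric.closedBall 0 1 := by
    rw [hDb, closure_ball _ one_ne_zero]
  have hz1 : ∀ i, ‖z i‖ < 1 := by
    have := hKD hz
    rw [hD] at this
    exact this
  have hn : n ≠ 0 := by
    rintro rfl
    rw [hfr] at hdist
    have : Metric.sphere (0 : Fin 0 → ℂ) 1 = ∅ := by
      ext w
      rw [Subsingleton.elim w 0, mem_sphere_zero_iff_norm, norm_zero]
      simp
    rw [this] at hdist
    simp at hdist
    exact hd.ne' hdist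
  have hdi : ∀ i, d + ‖z i‖ ≤ 1 := by
    intro i
    obtain ⟨u, hu1, hu2⟩ : ∃ u : ℂ, ‖u‖ = 1 ∧ ‖z i - u‖ = 1 - ‖z i‖ := by
      by_cases h0 : z i = 0
      · exact ⟨1, by simp, by simp [h0]⟩
      · have hp : 0 < ‖z i‖ := norm_pos_iff.2 h0
        refine ⟨((‖z i‖⁻¹ : ℝ) : ℂ) * z i, ?_, ?_⟩
        · rw [norm_mul, Complex.norm_real, norm_inv, norm_norm, inv_mul_cancel₀ hp.ne']
        · have : z i - ((‖z i‖⁻¹ : ℝ) : ℂ) * z i = (((1 - ‖z i‖⁻¹) : ℝ) : ℂ) * z i := by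
            push_cast; ring
          rw [this, norm_mul, Complex.norm_real, Real.norm_eq_abs, abs_of_nonpos]
          · field_simp
            ring
          · have := (one_le_inv₀ hp).2 (hz1 i).le
            linarith
    have hw : Function.update z i u ∈ frontier D := by
      rw [hfr, mem_sphere_zero_iff_norm]
      apply le_antisymm
      · rw [pi_norm_le_iff_of_nonneg zero_le_one]
        intro j
        by_cases hj : j = i
        · subst hj; simp [hu1]
        · simp [hj, (hz1 j).le]
      · have := norm_le_pi_norm (Function.update z i u) i
        simpa [hu1] using this
    have hle : d ≤ 1 - ‖z i‖ := by
      rw [hdist]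
      apply csInf_le
      · refine ⟨0, ?_⟩
        rintro t ⟨_, _, _, _, rfl⟩
        positivity
      · refine ⟨z, hz, _, hw, ?_⟩
        rw [Finset.sum_eq_single i]
        · rw [Function.update_self, hu2, Real.sqrt_sq]
          linarith [hz1 i]
        · intro j _ hj
          simp [hj]
        · simp
    linarith
  have hsub : Metric.ball z d ⊆ D := by
    intro w hw
    rw [hD]
    intro i
    rw [Metric.mem_ball, dist_eq_norm] at hw
    have h1 := norm_le_pi_norm (w - z) i
    have h2 : ‖w i‖ ≤ ‖w i - z i‖ + ‖z i‖ := by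
      simpa using norm_add_le (w i - z i) (z i)
    simp only [Pi.sub_apply] at h1
    linarith [hdi i]
  have hDsub : D ⊆ O := subset_closure.trans hDO
  have hsm := bergman_submean n (fun w => f w ^ 2) z d ((hf.mono (hsub.trans hDsub)).pow 2)
  have hint : IntegrableOn (fun w => f w ^ 2) D := by
    have hc : ContinuousOn (fun w => f w ^ 2) (closure D) :=
      (hf.continuousOn.mono hDO).pow 2
    have hcomp : IsCompact (closure D) := by
      rw [hcl]; exact isCompact_closedBall _ _
    exact (hc.integrableOn_compact hcomp).mono_set subset_closure
  have hvol : volume (Metric.ball z d) = ENNReal.ofReal ((Real.pi * d ^ 2) ^ n) := by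
    rw [volume_pi_ball _ hd]
    simp only [Complex.volume_ball, Finset.prod_const, Finset.card_univ, Fintype.card_fin]
    rw [ENNReal.ofReal_pow (by positivity), mul_comm Real.pi, ENNReal.ofReal_mul (by positivity),
      ENNReal.ofReal_pow hd.le]
    congr 2
    rw [← NNReal.coe_real_pi, ENNReal.ofReal_coe_nnreal]
  have hmain : ‖f z‖ ^ 2 * (Real.pi * d ^ 2) ^ n ≤ ∫ w in D, ‖f w‖ ^ 2 := by
    have h3 := hsm.trans (lintegral_mono_set hsub)
    rw [← ofReal_integral_norm_eq_lintegral_enorm hint, hvol, ← ofReal_norm,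
      ← ENNReal.ofReal_mul (norm_nonneg _), ENNReal.ofReal_le_ofReal_iff (by positivity)] at h3
    simpa [norm_pow] using h3
  have hs : ‖f z‖ * (Real.sqrt Real.pi * d) ^ n ≤ Real.sqrt (∫ w in D, ‖f w‖ ^ 2) := by
    apply Real.le_sqrt_of_sq_le
    refine le_trans (le_of_eq ?_) hmain
    rw [mul_pow, ← pow_mul, mul_comm n 2, pow_mul, mul_pow (Real.sqrt _), Real.sq_sqrt Real.pi_pos.le]
  have hsn : 1 ≤ (Real.sqrt n) ^ n := by
    apply one_le_pow₀
    rw [Real.one_le_sqrt]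
    exact_mod_cast Nat.one_le_iff_ne_zero.2 hn
  have hpos : 0 < (Real.sqrt Real.pi * d) ^ n := by
    have := Real.sqrt_pos.2 Real.pi_pos
    positivity
  rw [div_mul_eq_mul_div, le_div_iff₀ hpos]
  refine hs.trans ?_
  exact le_mul_of_one_le_left (Real.sqrt_nonneg _) hsn
end

section
/- Let Y ⊆ ℂⁿ be a nonempty connected open set and X ⊆ Y a nonempty open subset. Suppose there is a constant C > 0 such that for every bounded holomorphic function f on X there exists a bounded holomorphic function F on Y with F|_X = f and sup_Y |F| ≤ C·sup_X |f|. Then the restriction map is an isometry: for every bounded holomorphic function F on Y, sup_Y |F| = sup_X |F|. -/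
open Set Filter Topology in
theorem ident_aux {n : ℕ} {Y X : Set (Fin n → ℂ)} (hY : IsOpen Y) (hYc : IsConnected Y)
    (hX : IsOpen X) (hXY : X ⊆ Y) (hXne : X.Nonempty) (g : (Fin n → ℂ) → ℂ)
    (hg : DifferentiableOn ℂ g Y) (h0 : ∀ z ∈ X, g z = 0) : ∀ z ∈ Y, g z = 0 := by
  have hsub : Y ⊆ {z | ∀ᶠ w in 𝓝 z, g w = 0} := by
    apply hYc.isPreconnected.subset_of_closure_inter_subset isOpen_setOfPred_eventually_nhds
    · obtain ⟨x, hx⟩ := hXne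
      exact ⟨x, hXY hx, Filter.mem_of_superset (hX.mem_nhds hx) h0⟩
    · rintro z ⟨hzc, hzY⟩
      obtain ⟨r, hr, hb⟩ := Metric.isOpen_iff.1 hY z hzY
      obtain ⟨w, hw, hwz⟩ := Metric.mem_closure_iff.1 hzc r hr
      have hwb : w ∈ Metric.ball z r := by rwa [Metric.mem_ball, dist_comm]
      refine Filter.mem_of_superset (Metric.ball_mem_nhds z hr) ?_
      intro v hv
      let L : ℂ → (Fin n → ℂ) := fun t => w + t • (v - w)
      have hL : Differentiable ℂ L := by
        intro t
        exact (differentiableAt_const _).add (differentiableAt_id.smul_const _)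
      have hUo : IsOpen (L ⁻¹' Metric.ball z r) := Metric.isOpen_ball.preimage hL.continuous
      have hUc : Convex ℝ (L ⁻¹' Metric.ball z r) := by
        intro s hs t ht a b ha hb' hab
        have := convex_ball z r hs ht ha hb' hab
        have e : L (a • s + b • t) = a • L s + b • L t := by
          have hab' : (a : ℂ) + b = 1 := by exact_mod_cast hab
          ext i
          simp only [L, Pi.add_apply, Pi.smul_apply, Pi.sub_apply, smul_eq_mul, Complex.real_smul]
          linear_combination (-(w i)) * hab'
        rw [Set.mem_preimage, e]
        exact this
      have han : AnalyticOnNhd ℂ (g ∘ L) (L ⁻¹' Metric.ball z r) :=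
        DifferentiableOn.analyticOnNhd
          ((hg.mono hb).comp hL.differentiableOn (fun _ h => h)) hUo
      have hz0 : L 0 = w := by simp [L]
      have hz1 : L 1 = v := by simp [L]
      have h := han.eqOn_zero_of_preconnected_of_eventuallyEq_zero hUc.isPreconnected
        (z₀ := 0) (by simpa [hz0] using hwb)
        (by
          have : Tendsto L (𝓝 0) (𝓝 w) := by
            simpa [hz0] using hL.continuous.tendsto 0
          exact this.eventually hw)
        (show (1 : ℂ) ∈ L ⁻¹' Metric.ball z r by simpa [hz1] using hv)
      simpa [hz1] using h
  intro z hz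
  exact (hsub hz).self_of_nhds


/-- If every bounded holomorphic function on `X` extends to a bounded
holomorphic function on the connected open set `Y ⊇ X` with sup norm bounded
by `C` times the original, then restriction of sup norms from `Y` to `X` is an
isometry. -/
theorem restriction_isometry (n : ℕ) (Y X : Set (Fin n → ℂ))
    (hY : IsOpen Y) (hYc : IsConnected Y) (hYne : Y.Nonempty)
    (hX : IsOpen X) (hXY : X ⊆ Y) (hXne : X.Nonempty)
    (C : ℝ) (hC : 0 < C)
    (hext : ∀ f : (Fin n → ℂ) → ℂ, DifferentiableOn ℂ f X →
      (∃ M, ∀ z ∈ X, ‖f z‖ ≤ M) →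
      ∃ F : (Fin n → ℂ) → ℂ, DifferentiableOn ℂ F Y ∧
        (∀ z ∈ X, F z = f z) ∧
        ∀ z ∈ Y, ‖F z‖ ≤ C * sSup ((fun w => ‖f w‖) '' X)) :
    ∀ F : (Fin n → ℂ) → ℂ, DifferentiableOn ℂ F Y →
      (∃ M, ∀ z ∈ Y, ‖F z‖ ≤ M) →
      sSup ((fun z => ‖F z‖) '' Y) = sSup ((fun z => ‖F z‖) '' X) := by
  intro F hF ⟨M, hM⟩
  have hbX : BddAbove ((fun z => ‖F z‖) '' X) := by
    refine ⟨M, ?_⟩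
    rintro _ ⟨z, hz, rfl⟩
    exact hM z (hXY hz)
  have hbY : BddAbove ((fun z => ‖F z‖) '' Y) := by
    refine ⟨M, ?_⟩
    rintro _ ⟨z, hz, rfl⟩
    exact hM z hz
  apply le_antisymm
  · apply csSup_le (hYne.image _)
    rintro _ ⟨z, hz, rfl⟩
    show ‖F z‖ ≤ _
    set a := sSup ((fun z => ‖F z‖) '' X) with ha
    have hle : ∀ w ∈ X, ‖F w‖ ≤ a := fun w hw => le_csSup hbX ⟨w, hw, rfl⟩
    have ha0 : 0 ≤ a := by
      obtain ⟨x, hx⟩ := hXne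
      exact (norm_nonneg _).trans (hle x hx)
    have key : ∀ k : ℕ, ‖F z‖ ^ k ≤ C * a ^ k := by
      intro k
      have hFk : DifferentiableOn ℂ (fun z => F z ^ k) Y := hF.pow k
      have hbd : ∀ w ∈ X, ‖F w ^ k‖ ≤ a ^ k := by
        intro w hw
        rw [norm_pow]
        exact pow_le_pow_left₀ (norm_nonneg _) (hle w hw) k
      obtain ⟨G, hG, hGX, hGb⟩ := hext (fun z => F z ^ k) (hFk.mono hXY) ⟨a ^ k, hbd⟩
      have h0 := ident_aux hY hYc hX hXY hXne (fun z => G z - F z ^ k) (hG.sub hFk)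
        (fun w hw => by simp [hGX w hw]) z hz
      have h1 : G z = F z ^ k := sub_eq_zero.1 h0
      rw [← norm_pow, ← h1]
      refine (hGb z hz).trans (mul_le_mul_of_nonneg_left ?_ hC.le)
      apply csSup_le (hXne.image _)
      rintro _ ⟨w, hw, rfl⟩
      exact hbd w hw
    by_contra! hlt
    have hb : 0 < ‖F z‖ := ha0.trans_lt hlt
    obtain ⟨k, hk⟩ := exists_pow_lt_of_lt_one (inv_pos.2 hC) ((div_lt_one hb).2 hlt)
    rw [div_pow, div_lt_iff₀ (pow_pos hb k), inv_mul_eq_div, lt_div_iff₀ hC] at hk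
    linarith [key k]
  · exact csSup_le_csSup hbY (hXne.image _) (Set.image_mono hXY)
end
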